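/- Zero-error vs two-sided error randomized query complexity: R_0(f) = O(R_2(f)^2 · log N) for every total Boolean function f on N variables. -/

import Mathlib

inductive DTree (N : ℕ) : Type
  | leaf : Bool → DTree N
  | node : Fin N → DTree N → DTree N → DTree N

def DTree.eval {N : ℕ} : DTree N → (Fin N → Bool) → Bool
  | .leaf b, _ => b
  | .node i t0 t1, x => if x i then t1.eval x else t0.eval x

def DTree.depth {N : ℕ} : DTree N → ℕ
  | .leaf _ => 0
  | .node _ t0 t1 => 1 + max t0.depth t1.depth

def DTree.queries {N : ℕ} : DTree N → (Fin N → Bool) → Finset (Fin N)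
  | .leaf _, _ => ∅
  | .node i t0 t1, x => insert i (if x i then t1.queries x else t0.queries x)

noncomputable def Dcomplexity {N : ℕ} (f : (Fin N → Bool) → Bool) : ℕ :=
  sInf {d | ∃ T : DTree N, T.depth ≤ d ∧ ∀ x, T.eval x = f x}

/-- A randomized decision tree: a finitely supported probability distribution over
deterministic decision trees. -/
structure RandTree (N : ℕ) where
  m : ℕ
  w : Fin m → ℝ
  nonneg : ∀ i, 0 ≤ w i
  sum_one : ∑ i, w i = 1
  tree : Fin m → DTree N

/-- every tree in the support has depth at most `q` -/
def RandTree.depthLE {N : ℕ} (R : RandTree N) (q : ℕ) : Prop :=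
  ∀ i, R.w i ≠ 0 → (R.tree i).depth ≤ q

noncomputable def RandTree.probOutput {N : ℕ} (R : RandTree N) (x : Fin N → Bool) (b : Bool) : ℝ :=
  ∑ i, if (R.tree i).eval x = b then R.w i else 0

noncomputable def RandTree.probQueries {N : ℕ} (R : RandTree N) (x : Fin N → Bool)
    (B : Finset (Fin N)) : ℝ :=
  ∑ i, if ((R.tree i).queries x ∩ B) ≠ ∅ then R.w i else 0

/-- two-sided bounded error randomized query complexity (success probability ≥ 4/5) -/
noncomputable def R2 {N : ℕ} (f : (Fin N → Bool) → Bool) : ℕ :=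
  sInf {q | ∃ R : RandTree N, R.depthLE q ∧ ∀ x, 4/5 ≤ R.probOutput x (f x)}

/-- decision trees that may answer `none` ("?") -/
inductive DTree3 (N : ℕ) : Type
  | leaf : Option Bool → DTree3 N
  | node : Fin N → DTree3 N → DTree3 N → DTree3 N

def DTree3.eval {N : ℕ} : DTree3 N → (Fin N → Bool) → Option Bool
  | .leaf b, _ => b
  | .node i t0 t1, x => if x i then t1.eval x else t0.eval x

def DTree3.depth {N : ℕ} : DTree3 N → ℕ
  | .leaf _ => 0
  | .node _ t0 t1 => 1 + max t0.depth t1.depth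

structure RandTree3 (N : ℕ) where
  m : ℕ
  w : Fin m → ℝ
  nonneg : ∀ i, 0 ≤ w i
  sum_one : ∑ i, w i = 1
  tree : Fin m → DTree3 N

/-- zero-error (Las Vegas) randomized query complexity: never wrong, "?" with prob ≤ 1/5 -/
noncomputable def R0 {N : ℕ} (f : (Fin N → Bool) → Bool) : ℕ :=
  sInf {q | ∃ R : RandTree3 N,
    (∀ i, R.w i ≠ 0 → (R.tree i).depth ≤ q) ∧
    (∀ x, ∀ i, R.w i ≠ 0 → (R.tree i).eval x = some (f x) ∨ (R.tree i).eval x = none) ∧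
    (∀ x, (∑ i, if (R.tree i).eval x = none then R.w i else 0) ≤ 1/5)}

namespace DTree

variable {N : ℕ}

/-- The tree querying all variables of a list, then evaluating `f` on the updated assignment. -/
def queryAll (f : (Fin N → Bool) → Bool) : List (Fin N) → (Fin N → Bool) → DTree N
  | [], a => .leaf (f a)
  | i :: l, a =>
    .node i (queryAll f l (Function.update a i false)) (queryAll f l (Function.update a i true))

theorem depth_queryAll (f : (Fin N → Bool) → Bool) (l : List (Fin N)) (a : Fin N → Bool) :
    (queryAll f l a).depth = l.length := by
  induction l generalizing a with
  | nil => rfl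
  | cons i l ih => simp [queryAll, depth, ih, add_comm]

theorem eval_queryAll (f : (Fin N → Bool) → Bool) (l : List (Fin N)) (a x : Fin N → Bool)
    (h : ∀ i, i ∉ l → a i = x i) : (queryAll f l a).eval x = f x := by
  induction l generalizing a with
  | nil =>
    have : a = x := funext fun i => h i (by simp)
    simp [queryAll, eval, this]
  | cons i l ih =>
    have key : ∀ b, x i = b → ∀ j, j ∉ l → Function.update a i b j = x j := by
      intro b hb j hj
      by_cases hji : j = i
      · subst hji; simp [hb]
      · rw [Function.update_of_ne hji]; exact h j (by simp [hji, hj])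
    cases hx : x i
    · simpa [queryAll, eval, hx] using ih _ (key _ hx)
    · simpa [queryAll, eval, hx] using ih _ (key _ hx)

theorem exists_eval_eq (f : (Fin N → Bool) → Bool) :
    ∃ T : DTree N, T.depth ≤ N ∧ ∀ x, T.eval x = f x :=
  ⟨queryAll f (List.finRange N) fun _ => false, by simp [depth_queryAll], fun x =>
    eval_queryAll f _ _ x fun i hi => absurd (List.mem_finRange i) hi⟩

theorem card_queries_le (T : DTree N) (x : Fin N → Bool) : (T.queries x).card ≤ T.depth := by
  induction T with
  | leaf b => simp [queries]
  | node i t0 t1 h0 h1 =>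
    refine (Finset.card_insert_le _ _).trans ?_
    simp only [depth]
    split_ifs <;> omega

theorem eval_congr (T : DTree N) {x y : Fin N → Bool} (h : ∀ i ∈ T.queries x, y i = x i) :
    T.eval y = T.eval x := by
  induction T with
  | leaf b => rfl
  | node i t0 t1 h0 h1 =>
    have hi : y i = x i := h i (by simp [queries])
    have hrest : ∀ j ∈ (if x i then t1.queries x else t0.queries x), y j = x j :=
      fun j hj => h j (Finset.mem_insert_of_mem hj)
    cases hx : x i
    · simpa [eval, hi, hx] using h0 (by simpa [hx] using hrest)
    · simpa [eval, hi, hx] using h1 (by simpa [hx] using hrest)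

/-- Run a tree while recording the set of inputs consistent with the answers, and pass that set to
a continuation. -/
def andThen : DTree N → (Set (Fin N → Bool) → DTree3 N) → Set (Fin N → Bool) → DTree3 N
  | .leaf _, k, K => k K
  | .node i t0 t1, k, K =>
    .node i (t0.andThen k (K ∩ {y | y i = false})) (t1.andThen k (K ∩ {y | y i = true}))

theorem depth_andThen_le (T : DTree N) (k : Set (Fin N → Bool) → DTree3 N) {d : ℕ}
    (hk : ∀ K, (k K).depth ≤ d) (K : Set (Fin N → Bool)) :
    (T.andThen k K).depth ≤ T.depth + d := by
  induction T generalizing K with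
  | leaf b => simpa [andThen, depth] using hk K
  | node i t0 t1 h0 h1 =>
    have := h0 (K ∩ {y | y i = false})
    have := h1 (K ∩ {y | y i = true})
    simp only [andThen, DTree3.depth, depth]
    omega

theorem eval_andThen (T : DTree N) (k : Set (Fin N → Bool) → DTree3 N) (K : Set (Fin N → Bool))
    (x : Fin N → Bool) :
    (T.andThen k K).eval x = (k (K ∩ {y | ∀ i ∈ T.queries x, y i = x i})).eval x := by
  induction T generalizing K with
  | leaf b => simp [andThen, queries]
  | node i t0 t1 h0 h1 =>
    cases hx : x i
    · simp only [andThen, DTree3.eval, hx, h0, queries, Finset.forall_mem_insert, Set.inter_assoc]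
      rfl
    · simp only [andThen, DTree3.eval, hx, h1, queries, Finset.forall_mem_insert, Set.inter_assoc]
      rfl

open Classical in
/-- The common value of `f` on `K`, or `none` if `f` is not constant on `K`. -/
noncomputable def verdict (f : (Fin N → Bool) → Bool) (K : Set (Fin N → Bool)) : Option Bool :=
  if ∀ y ∈ K, f y = true then some true else if ∀ y ∈ K, f y = false then some false else none

theorem verdict_eq (f : (Fin N → Bool) → Bool) {K : Set (Fin N → Bool)} {x : Fin N → Bool}
    (hx : x ∈ K) : verdict f K = some (f x) ∨ verdict f K = none := by
  unfold verdict
  split_ifs with h1 h2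
  · simp [h1 x hx]
  · simp [h2 x hx]
  · simp

theorem exists_ne_of_verdict_eq_none {f : (Fin N → Bool) → Bool} {K : Set (Fin N → Bool)}
    (h : verdict f K = none) (x : Fin N → Bool) : ∃ y ∈ K, f y ≠ f x := by
  by_contra! hc
  unfold verdict at h
  split_ifs at h with h1 h2
  cases hx : f x
  · exact h2 fun y hy => (hc y hy).trans hx
  · exact h1 fun y hy => (hc y hy).trans hx

/-- Run all trees of a list, and answer if the queried variables certify the value of `f`. -/
noncomputable def certify (f : (Fin N → Bool) → Bool) :
    List (DTree N) → Set (Fin N → Bool) → DTree3 N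
  | [], K => .leaf (verdict f K)
  | T :: l, K => T.andThen (certify f l) K

theorem depth_certify_le (f : (Fin N → Bool) → Bool) {q : ℕ} (l : List (DTree N))
    (hl : ∀ T ∈ l, T.depth ≤ q) (K : Set (Fin N → Bool)) :
    (certify f l K).depth ≤ l.length * q := by
  induction l generalizing K with
  | nil => simp [certify, DTree3.depth]
  | cons T l ih =>
    have h1 := depth_andThen_le T (certify f l) (ih fun S hS => hl S (by simp [hS])) K
    have h2 := hl T (by simp)
    simp only [certify, List.length_cons]
    linarith

theorem eval_certify (f : (Fin N → Bool) → Bool) (l : List (DTree N)) (K : Set (Fin N → Bool))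
    (x : Fin N → Bool) :
    (certify f l K).eval x = verdict f (K ∩ {y | ∀ T ∈ l, ∀ i ∈ T.queries x, y i = x i}) := by
  induction l generalizing K with
  | nil => simp [certify, DTree3.eval]
  | cons T l ih =>
    simp only [certify, eval_andThen, ih, List.forall_mem_cons, Set.inter_assoc]
    rfl

end DTree

section

variable {N : ℕ}

theorem R0_le_of_fintype {f : (Fin N → Bool) → Bool} {ι : Type*} [Fintype ι] (w : ι → ℝ)
    (tree : ι → DTree3 N) {q : ℕ} (nonneg : ∀ i, 0 ≤ w i) (sum_one : ∑ i, w i = 1)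
    (hq : ∀ i, w i ≠ 0 → (tree i).depth ≤ q)
    (hf : ∀ x i, w i ≠ 0 → (tree i).eval x = some (f x) ∨ (tree i).eval x = none)
    (herr : ∀ x, (∑ i, if (tree i).eval x = none then w i else 0) ≤ 1 / 5) : R0 f ≤ q := by
  let e := (Fintype.equivFin ι).symm
  refine Nat.sInf_le ⟨⟨Fintype.card ι, w ∘ e, fun i => nonneg _, ?_, tree ∘ e⟩,
    fun i => hq _, fun x i => hf x _, fun x => ?_⟩
  · exact (e.sum_comp w).trans sum_one
  · exact (e.sum_comp fun i => if (tree i).eval x = none then w i else 0).trans_le (herr x)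

theorem exists_randTree_depthLE {f : (Fin N → Bool) → Bool} :
    ∃ R : RandTree N, R.depthLE N ∧ ∀ x, 4 / 5 ≤ R.probOutput x (f x) := by
  obtain ⟨T, hT, hf⟩ := DTree.exists_eval_eq f
  refine ⟨⟨1, fun _ => 1, by simp, by simp, fun _ => T⟩, fun _ _ => hT, fun x => ?_⟩
  simp only [RandTree.probOutput, hf]
  norm_num

theorem R2_le (f : (Fin N → Bool) → Bool) : R2 f ≤ N :=
  Nat.sInf_le exists_randTree_depthLE

theorem exists_randTree_depthLE_R2 (f : (Fin N → Bool) → Bool) :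
    ∃ R : RandTree N, R.depthLE (R2 f) ∧ ∀ x, 4 / 5 ≤ R.probOutput x (f x) :=
  Nat.sInf_mem (s := {q | ∃ R : RandTree N, R.depthLE q ∧ ∀ x, 4 / 5 ≤ R.probOutput x (f x)})
    ⟨N, exists_randTree_depthLE⟩

/-- Two inputs with different values are rarely left undistinguished. -/
theorem RandTree.sum_not_separated_le (R : RandTree N) {f : (Fin N → Bool) → Bool}
    (hR : ∀ x, 4 / 5 ≤ R.probOutput x (f x)) {x y : Fin N → Bool} (hxy : f y ≠ f x) :
    (∑ j, if ∀ i ∈ (R.tree j).queries x, y i = x i then R.w j else 0) ≤ 2 / 5 := by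
  have key : R.probOutput x (f x) + R.probOutput y (f y) +
      (∑ j, if ∀ i ∈ (R.tree j).queries x, y i = x i then R.w j else 0) ≤
      ∑ j, (R.w j + R.w j) := by
    unfold RandTree.probOutput
    rw [← Finset.sum_add_distrib, ← Finset.sum_add_distrib]
    refine Finset.sum_le_sum fun j _ => ?_
    have hw := R.nonneg j
    by_cases h : ∀ i ∈ (R.tree j).queries x, y i = x i
    · rw [if_pos h, (R.tree j).eval_congr h]
      split_ifs with h1 h2
      · exact absurd (h2.symm.trans h1) hxy
      all_goals linarith
    · rw [if_neg h]
      split_ifs <;> linarith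
  rw [Finset.sum_add_distrib, R.sum_one] at key
  linarith [hR x, hR y]

/-- An input has few sensitive coordinates. -/
theorem RandTree.card_sensitive_le (R : RandTree N) {f : (Fin N → Bool) → Bool} {q : ℕ}
    (hq : R.depthLE q) (hR : ∀ x, 4 / 5 ≤ R.probOutput x (f x)) (y : Fin N → Bool)
    (D : Finset (Fin N)) (hD : ∀ i ∈ D, ∃ b, f (Function.update y i b) ≠ f y) :
    D.card ≤ 2 * q := by
  have h1 : ∀ i ∈ D, 3 / 5 ≤ ∑ j, if i ∈ (R.tree j).queries y then R.w j else 0 := by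
    intro i hi
    obtain ⟨b, hb⟩ := hD i hi
    have h := R.sum_not_separated_le hR hb
    have : (1 : ℝ) ≤ (∑ j, if i ∈ (R.tree j).queries y then R.w j else 0) +
        ∑ j, if ∀ l ∈ (R.tree j).queries y, Function.update y i b l = y l then R.w j else 0 := by
      rw [← R.sum_one, ← Finset.sum_add_distrib]
      refine Finset.sum_le_sum fun j _ => ?_
      have hw := R.nonneg j
      by_cases hij : i ∈ (R.tree j).queries y
      · rw [if_pos hij]; split_ifs <;> linarith
      · rw [if_neg hij, if_pos]
        · simp
        · intro l hl
          exact Function.update_of_ne (ne_of_mem_of_not_mem hl hij) _ _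
    linarith
  have h2 : (D.card : ℝ) * (3 / 5) ≤ q := by
    calc (D.card : ℝ) * (3 / 5) = ∑ i ∈ D, (3 / 5 : ℝ) := by simp
      _ ≤ ∑ i ∈ D, ∑ j, if i ∈ (R.tree j).queries y then R.w j else 0 := Finset.sum_le_sum h1
      _ = ∑ j, ∑ i ∈ D, if i ∈ (R.tree j).queries y then R.w j else 0 := Finset.sum_comm
      _ ≤ ∑ j, R.w j * q := by
        refine Finset.sum_le_sum fun j _ => ?_
        rw [← Finset.sum_filter, Finset.sum_const, nsmul_eq_mul, mul_comm]
        by_cases hw : R.w j = 0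
        · simp [hw]
        · refine mul_le_mul_of_nonneg_left ?_ (R.nonneg j)
          have hsub : D.filter (· ∈ (R.tree j).queries y) ⊆ (R.tree j).queries y :=
            fun i hi => (Finset.mem_filter.1 hi).2
          exact_mod_cast (Finset.card_le_card hsub).trans
            (((R.tree j).card_queries_le y).trans (hq j hw))
      _ = q := by rw [← Finset.sum_mul, R.sum_one, one_mul]
  have h3 : (D.card : ℝ) ≤ 2 * q := by
    have : (0 : ℝ) ≤ q := q.cast_nonneg
    linarith
  exact_mod_cast h3

/-- The set of coordinates where two inputs differ. -/
def diffSet (x y : Fin N → Bool) : Finset (Fin N) := Finset.univ.filter fun i => y i ≠ x i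

theorem mem_diffSet {x y : Fin N → Bool} {i : Fin N} : i ∈ diffSet x y ↔ y i ≠ x i := by
  simp [diffSet]

theorem diffSet_injective (x : Fin N → Bool) : Function.Injective (diffSet x) := by
  intro y z h
  funext i
  have := Finset.ext_iff.1 h i
  rw [mem_diffSet, mem_diffSet] at this
  cases hy : y i <;> cases hz : z i <;> cases hx : x i <;> simp_all

open Classical in
/-- The inputs with a value different from that of `x` which differ from `x` in a minimal set. -/
noncomputable def minimalDiff (f : (Fin N → Bool) → Bool) (x : Fin N → Bool) :
    Finset (Fin N → Bool) :=
  Finset.univ.filter fun y => f y ≠ f x ∧ ∀ z, diffSet x z ⊂ diffSet x y → f z = f x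

theorem mem_minimalDiff {f : (Fin N → Bool) → Bool} {x y : Fin N → Bool} :
    y ∈ minimalDiff f x ↔ f y ≠ f x ∧ ∀ z, diffSet x z ⊂ diffSet x y → f z = f x := by
  simp [minimalDiff]

theorem exists_mem_minimalDiff {f : (Fin N → Bool) → Bool} {x : Fin N → Bool} (y : Fin N → Bool)
    (hy : f y ≠ f x) : ∃ z ∈ minimalDiff f x, diffSet x z ⊆ diffSet x y := by
  induction h : (diffSet x y).card using Nat.strong_induction_on generalizing y with
  | _ n ih =>
    by_cases hm : ∀ z, diffSet x z ⊂ diffSet x y → f z = f x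
    · exact ⟨y, mem_minimalDiff.2 ⟨hy, hm⟩, subset_rfl⟩
    · push Not at hm
      obtain ⟨z, hz, hfz⟩ := hm
      obtain ⟨u, hu, huz⟩ := ih _ (h ▸ Finset.card_lt_card hz) z hfz rfl
      exact ⟨u, hu, huz.trans hz.subset⟩

theorem RandTree.card_diffSet_le (R : RandTree N) {f : (Fin N → Bool) → Bool} {q : ℕ}
    (hq : R.depthLE q) (hR : ∀ x, 4 / 5 ≤ R.probOutput x (f x)) {x y : Fin N → Bool}
    (hy : y ∈ minimalDiff f x) : (diffSet x y).card ≤ 2 * q := by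
  obtain ⟨hy, hmin⟩ := mem_minimalDiff.1 hy
  refine R.card_sensitive_le hq hR y _ fun i hi => ⟨x i, ?_⟩
  rw [hmin]
  · exact hy.symm
  · refine Finset.ssubset_iff_of_subset (fun j hj => ?_) |>.2 ⟨i, hi, by simp [mem_diffSet]⟩
    rw [mem_diffSet] at hj ⊢
    by_cases hji : j = i
    · subst hji; simp at hj
    · rwa [Function.update_of_ne hji] at hj

theorem Finset.exists_image_univ_eq {α : Type*} [DecidableEq α] {s : Finset α} (hs : s.Nonempty)
    {L : ℕ} (hL : s.card ≤ L) : ∃ g : Fin L → α, Finset.univ.image g = s := by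
  obtain ⟨a, ha⟩ := hs
  refine ⟨fun j => if h : j.1 < s.card then s.equivFin.symm ⟨j, h⟩ else a, ?_⟩
  ext b
  simp only [Finset.mem_image, Finset.mem_univ, true_and]
  constructor
  · rintro ⟨j, rfl⟩
    split_ifs with h
    · exact (s.equivFin.symm ⟨j, h⟩).2
    · exact ha
  · intro hb
    refine ⟨⟨s.equivFin ⟨b, hb⟩, (Fin.is_lt _).trans_le hL⟩, ?_⟩
    simp

theorem card_minimalDiff_le {f : (Fin N → Bool) → Bool} {x : Fin N → Bool} {L : ℕ}
    (hL : ∀ y ∈ minimalDiff f x, (diffSet x y).card ≤ L) : (minimalDiff f x).card ≤ N ^ L := by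
  classical
  have hsub : (minimalDiff f x).image (diffSet x) ⊆
      (Finset.univ : Finset (Fin L → Fin N)).image fun g => Finset.univ.image g := by
    intro D hD
    obtain ⟨y, hy, rfl⟩ := Finset.mem_image.1 hD
    have hne : (diffSet x y).Nonempty := by
      by_contra hc
      refine (mem_minimalDiff.1 hy).1 (congrArg f (funext fun i => ?_))
      by_contra hi
      exact hc ⟨i, mem_diffSet.2 hi⟩
    obtain ⟨g, hg⟩ := Finset.exists_image_univ_eq hne (hL y hy)
    exact Finset.mem_image.2 ⟨g, Finset.mem_univ _, hg⟩
  calc (minimalDiff f x).card = ((minimalDiff f x).image (diffSet x)).card :=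
        (Finset.card_image_of_injective _ (diffSet_injective x)).symm
    _ ≤ _ := Finset.card_le_card hsub
    _ ≤ _ := Finset.card_image_le
    _ = N ^ L := by simp

theorem R0_le_of_randTree (R : RandTree N) {f : (Fin N → Bool) → Bool} {q k : ℕ}
    (hq : R.depthLE q) (hR : ∀ x, 4 / 5 ≤ R.probOutput x (f x))
    (hk : (N : ℝ) ^ (2 * q) * (2 / 5) ^ k ≤ 1 / 5) : R0 f ≤ k * q := by
  have hsupp : ∀ g : Fin k → Fin R.m, ∏ j, R.w (g j) ≠ 0 → ∀ j, R.w (g j) ≠ 0 :=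
    fun g hg j => Finset.prod_ne_zero_iff.1 hg j (Finset.mem_univ j)
  have hnonneg : ∀ g : Fin k → Fin R.m, 0 ≤ ∏ j, R.w (g j) :=
    fun g => Finset.prod_nonneg fun j _ => R.nonneg _
  refine R0_le_of_fintype (ι := Fin k → Fin R.m) (fun g => ∏ j, R.w (g j))
    (fun g => DTree.certify f (List.ofFn fun j => R.tree (g j)) Set.univ) hnonneg ?_ ?_ ?_ ?_
  · rw [← Fintype.sum_pow, R.sum_one, one_pow]
  · intro g hg
    have := DTree.depth_certify_le f (q := q) (List.ofFn fun j => R.tree (g j)) (by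
      intro T hT
      obtain ⟨j, rfl⟩ := (List.mem_ofFn' _ _).1 hT
      exact hq _ (hsupp g hg j)) Set.univ
    simpa using this
  · intro x g _
    rw [DTree.eval_certify]
    exact DTree.verdict_eq f (by simp)
  · intro x
    have hpt : ∀ g : Fin k → Fin R.m,
        (if (DTree.certify f (List.ofFn fun j => R.tree (g j)) Set.univ).eval x = none
          then ∏ j, R.w (g j) else 0) ≤
        ∑ y ∈ minimalDiff f x,
          ∏ j, if ∀ i ∈ (R.tree (g j)).queries x, y i = x i then R.w (g j) else 0 := by
      intro g
      have hterm : ∀ y ∈ minimalDiff f x,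
          0 ≤ ∏ j, if ∀ i ∈ (R.tree (g j)).queries x, y i = x i then R.w (g j) else 0 :=
        fun y _ => Finset.prod_nonneg fun j _ => by
          split_ifs
          exacts [R.nonneg _, le_rfl]
      split_ifs with h
      · rw [DTree.eval_certify] at h
        obtain ⟨y, ⟨-, hyK⟩, hy⟩ := DTree.exists_ne_of_verdict_eq_none h x
        obtain ⟨z, hz, hzy⟩ := exists_mem_minimalDiff y hy
        refine le_trans (le_of_eq ?_) (Finset.single_le_sum hterm hz)
        refine Finset.prod_congr rfl fun j _ => (if_pos fun i hi => ?_).symm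
        by_contra hne
        exact mem_diffSet.1 (hzy (mem_diffSet.2 hne))
          (hyK _ ((List.mem_ofFn' _ _).2 ⟨j, rfl⟩) i hi)
      · exact Finset.sum_nonneg hterm
    calc _ ≤ ∑ g : Fin k → Fin R.m, ∑ y ∈ minimalDiff f x,
          ∏ j, (if ∀ i ∈ (R.tree (g j)).queries x, y i = x i then R.w (g j) else 0) :=
          Finset.sum_le_sum fun g _ => hpt g
      _ = ∑ y ∈ minimalDiff f x,
          (∑ l, if ∀ i ∈ (R.tree l).queries x, y i = x i then R.w l else 0) ^ k := by
          rw [Finset.sum_comm]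
          refine Finset.sum_congr rfl fun y _ => ?_
          rw [Fintype.sum_pow]
      _ ≤ ∑ y ∈ minimalDiff f x, (2 / 5 : ℝ) ^ k := by
          refine Finset.sum_le_sum fun y hy => pow_le_pow_left₀ ?_
            (R.sum_not_separated_le hR (mem_minimalDiff.1 hy).1) k
          refine Finset.sum_nonneg fun l _ => ?_
          split_ifs
          exacts [R.nonneg _, le_rfl]
      _ = (minimalDiff f x).card * (2 / 5 : ℝ) ^ k := by simp
      _ ≤ (N : ℝ) ^ (2 * q) * (2 / 5) ^ k := by
          gcongr
          exact_mod_cast card_minimalDiff_le fun y hy => R.card_diffSet_le hq hR hy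
      _ ≤ 1 / 5 := hk

theorem R0_le_R2 (f : (Fin N → Bool) → Bool) :
    R0 f ≤ (2 * R2 f * (Nat.log 2 N + 1) + 3) * R2 f := by
  obtain ⟨R, hq, hR⟩ := exists_randTree_depthLE_R2 f
  refine R0_le_of_randTree R hq hR ?_
  set q := R2 f
  have hN : (N : ℝ) ≤ 2 ^ (Nat.log 2 N + 1) := by
    exact_mod_cast (Nat.lt_pow_succ_log_self one_lt_two N).le
  set M := Nat.log 2 N + 1
  have h1 : (N : ℝ) ^ (2 * q) ≤ 2 ^ (2 * q * M) := by
    calc (N : ℝ) ^ (2 * q) ≤ (2 ^ M) ^ (2 * q) := pow_le_pow_left₀ N.cast_nonneg hN _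
      _ = 2 ^ (2 * q * M) := by rw [← pow_mul, mul_comm]
  calc (N : ℝ) ^ (2 * q) * (2 / 5) ^ (2 * q * M + 3)
      ≤ 2 ^ (2 * q * M) * (2 / 5) ^ (2 * q * M + 3) := by gcongr
    _ = (4 / 5) ^ (2 * q * M) * (2 / 5) ^ 3 := by rw [pow_add, ← mul_assoc, ← mul_pow]; norm_num
    _ ≤ 1 * (2 / 5) ^ 3 := by gcongr; exact pow_le_one₀ (by norm_num) (by norm_num)
    _ ≤ 1 / 5 := by norm_num

end

/-- `R_0(f) = O(R_2(f)^2 * log N)` for every total Boolean function. -/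
theorem stmt18 : ∃ C : ℝ, 0 < C ∧
    ∀ (N : ℕ) (f : (Fin N → Bool) → Bool),
      (R0 f : ℝ) ≤ C * (R2 f)^2 * Real.log N + C := by
  refine ⟨14, by norm_num, fun N f => ?_⟩
  have h := R0_le_R2 f
  rcases Nat.lt_or_ge N 2 with hN | hN
  · have hlog : Nat.log 2 N = 0 := Nat.log_of_lt hN
    have hq : R2 f ≤ 1 := (R2_le f).trans (by omega)
    have h5 : R0 f ≤ 14 := by
      rw [hlog] at h
      nlinarith
    have h0 : (0 : ℝ) ≤ 14 * (R2 f) ^ 2 * Real.log N :=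
      mul_nonneg (by positivity) (Real.log_natCast_nonneg N)
    have : (R0 f : ℝ) ≤ 14 := by exact_mod_cast h5
    linarith
  · have hcast : (R0 f : ℝ) ≤ (2 * R2 f * (Nat.log 2 N + 1) + 3) * R2 f := by exact_mod_cast h
    have hlog2 : (1 / 2 : ℝ) < Real.log 2 := by linarith [Real.log_two_gt_d9]
    have hlogN : Real.log 2 ≤ Real.log N := Real.log_le_log (by norm_num) (by exact_mod_cast hN)
    have hl : (Nat.log 2 N : ℝ) ≤ 2 * Real.log N := by
      have h1 : (Nat.log 2 N : ℝ) ≤ Real.logb 2 N := by exact_mod_cast Real.natLog_le_logb N 2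
      have h2 : Real.logb 2 N * Real.log 2 = Real.log N := by
        rw [Real.logb, div_mul_cancel₀]; linarith
      nlinarith [(Nat.log 2 N).cast_nonneg (α := ℝ)]
    have hqq : (R2 f : ℝ) ≤ (R2 f : ℝ) ^ 2 := by exact_mod_cast Nat.le_self_pow two_ne_zero _
    have hq2 : (0 : ℝ) ≤ (R2 f : ℝ) ^ 2 := by positivity
    have h3 : (R2 f : ℝ) ^ 2 * (Nat.log 2 N + 1) ≤ (R2 f : ℝ) ^ 2 * (4 * Real.log N) :=
      mul_le_mul_of_nonneg_left (by linarith) hq2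
    have h4 : (R2 f : ℝ) ^ 2 * 1 ≤ (R2 f : ℝ) ^ 2 * (2 * Real.log N) :=
      mul_le_mul_of_nonneg_left (by linarith) hq2
    nlinarith
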